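/- (Buchberger's product criterion) Let K be a field, σ a finite type of indeterminates, and fix an admissible monomial order ≼ on σ →₀ ℕ. Let p, q ∈ MvPolynomial σ K be nonzero polynomials whose leading monomials are coprime, i.e., min(lp(p)(x), lp(q)(x)) = 0 for every x ∈ σ (equivalently gcd(lp p, lp q) = 1). Then spoly(p,q) →*_{{p,q}} 0, i.e., the S-polynomial of p and q reduces to 0 modulo the two-element set {p, q}. -/

import Mathlib

open MvPolynomial Relation

/-- An admissible monomial order on `σ →₀ ℕ`: a linear order such that `0` is the
smallest element and which is compatible with addition. -/
structure AdmissibleOrder (σ : Type*) where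
  le : (σ →₀ ℕ) → (σ →₀ ℕ) → Prop
  total : ∀ s t, le s t ∨ le t s
  refl : ∀ t, le t t
  trans : ∀ s t u, le s t → le t u → le s u
  antisymm : ∀ s t, le s t → le t s → s = t
  zero_le : ∀ t, le 0 t
  add_right : ∀ s t u, le s t → le (s + u) (t + u)

namespace AdmissibleOrder

variable {σ : Type*} {K : Type*} [Field K]

/-- The strict part of an admissible order. -/
def lt (m : AdmissibleOrder σ) (s t : σ →₀ ℕ) : Prop := m.le s t ∧ s ≠ t

-- The leading monomial of a polynomial: the `m.le`-largest element of its support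
-- (`0` for the zero polynomial).
open Classical in
noncomputable def lm (m : AdmissibleOrder σ) (p : MvPolynomial σ K) : σ →₀ ℕ :=
  if h : ∃ v, v ∈ p.support ∧ ∀ u ∈ p.support, m.le u v then h.choose else 0

/-- The leading coefficient of a polynomial. -/
noncomputable def lc (m : AdmissibleOrder σ) (p : MvPolynomial σ K) : K :=
  coeff (m.lm p) p

/-- One-step polynomial reduction modulo a set `F`. -/
def Red (m : AdmissibleOrder σ) (F : Set (MvPolynomial σ K))
    (p q : MvPolynomial σ K) : Prop :=
  ∃ f ∈ F, f ≠ 0 ∧ ∃ t : σ →₀ ℕ,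
    coeff (t + m.lm f) p ≠ 0 ∧
    q = p - (coeff (t + m.lm f) p / m.lc f) • (monomial t (1 : K)) * f

/-- A set `G` is a Gröbner basis iff the reduction relation modulo `G` is confluent. -/
def IsGroebner (m : AdmissibleOrder σ) (G : Set (MvPolynomial σ K)) : Prop :=
  ∀ a b c : MvPolynomial σ K, ReflTransGen (m.Red G) a b → ReflTransGen (m.Red G) a c →
    ∃ d, ReflTransGen (m.Red G) b d ∧ ReflTransGen (m.Red G) c d

-- The S-polynomial of two polynomials.
open Classical in
noncomputable def spoly (m : AdmissibleOrder σ) (p q : MvPolynomial σ K) :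
    MvPolynomial σ K :=
  if p = 0 ∨ q = 0 then 0 else
    (monomial (m.lm p ⊔ m.lm q - m.lm p) (1 / m.lc p)) * p -
    (monomial (m.lm p ⊔ m.lm q - m.lm q) (1 / m.lc q)) * q

end AdmissibleOrder

namespace AdmissibleOrder

section Order

variable {σ : Type*} (m : AdmissibleOrder σ)

theorem le_of_pointwise_le {s t : σ →₀ ℕ} (h : s ≤ t) : m.le s t := by
  have h' := m.add_right 0 (t - s) s (m.zero_le _)
  rwa [zero_add, tsub_add_cancel_of_le h] at h'

theorem add_le_add {i a j b : σ →₀ ℕ} (hi : m.le i a) (hj : m.le j b) :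
    m.le (i + j) (a + b) := by
  refine m.trans _ _ _ (m.add_right _ _ j hi) ?_
  rw [add_comm a j, add_comm a b]
  exact m.add_right _ _ a hj

theorem eq_of_le_of_add_eq {i a j b : σ →₀ ℕ} (hi : m.le i a) (hj : m.le j b)
    (h : i + j = a + b) : i = a := by
  have h₁ : m.le (a + j) (i + j) := h ▸ m.add_le_add (m.refl a) hj
  exact add_right_cancel (m.antisymm _ _ (m.add_right _ _ j hi) h₁)

theorem exists_max (S : Finset (σ →₀ ℕ)) (hS : S.Nonempty) :
    ∃ v ∈ S, ∀ u ∈ S, m.le u v := by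
  classical
  induction hS using Finset.Nonempty.cons_induction with
  | singleton a => exact ⟨a, by simp, by simpa using m.refl a⟩
  | cons a S ha hS ih =>
    obtain ⟨v, hv, hmax⟩ := ih
    rcases m.total a v with h | h
    · refine ⟨v, by simp [hv], fun u hu => ?_⟩
      rcases Finset.mem_cons.1 hu with rfl | hu
      exacts [h, hmax u hu]
    · refine ⟨a, by simp, fun u hu => ?_⟩
      rcases Finset.mem_cons.1 hu with rfl | hu
      exacts [m.refl _, m.trans _ _ _ (hmax u hu) h]

end Order

variable {σ K : Type*} [Field K] (m : AdmissibleOrder σ)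

theorem lm_spec {p : MvPolynomial σ K} (hp : p ≠ 0) :
    m.lm p ∈ p.support ∧ ∀ u ∈ p.support, m.le u (m.lm p) := by
  have h : ∃ v, v ∈ p.support ∧ ∀ u ∈ p.support, m.le u v :=
    m.exists_max _ (support_nonempty.2 hp)
  rw [lm, dif_pos h]
  exact h.choose_spec

theorem lm_mem_support {p : MvPolynomial σ K} (hp : p ≠ 0) : m.lm p ∈ p.support :=
  (m.lm_spec hp).1

theorem le_lm {p : MvPolynomial σ K} {u : σ →₀ ℕ} (hu : u ∈ p.support) : m.le u (m.lm p) :=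
  (m.lm_spec (support_nonempty.1 ⟨u, hu⟩)).2 u hu

theorem lc_ne_zero {p : MvPolynomial σ K} (hp : p ≠ 0) : m.lc p ≠ 0 :=
  mem_support_iff.1 (m.lm_mem_support hp)

theorem le_lm_add_lm_of_mem_support_mul {f g : MvPolynomial σ K} {v : σ →₀ ℕ}
    (hv : v ∈ (f * g).support) : m.le v (m.lm f + m.lm g) := by
  classical
  obtain ⟨i, hi, j, hj, rfl⟩ := Finset.mem_add.1 (support_mul f g hv)
  exact m.add_le_add (m.le_lm hi) (m.le_lm hj)

theorem coeff_lm_add_lm_mul (f g : MvPolynomial σ K) :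
    coeff (m.lm f + m.lm g) (f * g) = m.lc f * m.lc g := by
  classical
  rw [coeff_mul]
  refine Finset.sum_eq_single (m.lm f, m.lm g) (fun x hx hne => ?_) (fun h => ?_)
  · by_contra hc
    rw [Finset.HasAntidiagonal.mem_antidiagonal] at hx
    obtain ⟨hx₁, hx₂⟩ := mul_ne_zero_iff.1 hc
    have h₁ := m.le_lm (mem_support_iff.2 hx₁)
    have h₂ := m.le_lm (mem_support_iff.2 hx₂)
    have h₃ := m.eq_of_le_of_add_eq h₁ h₂ hx
    rw [h₃] at hx
    exact hne (Prod.ext h₃ (add_left_cancel hx))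
  · simp at h

/-- A polynomial without its leading term. -/
noncomputable def tail (f : MvPolynomial σ K) : MvPolynomial σ K :=
  f - monomial (m.lm f) (m.lc f)

theorem coeff_lm_tail (f : MvPolynomial σ K) : coeff (m.lm f) (m.tail f) = 0 := by
  classical
  simp [tail, coeff_monomial, lc]

theorem support_tail_subset (f : MvPolynomial σ K) : (m.tail f).support ⊆ f.support := by
  classical
  intro v hv
  rw [mem_support_iff] at hv ⊢
  by_cases h : m.lm f = v
  · subst h
    exact absurd (m.coeff_lm_tail f) hv
  · simpa [tail, coeff_monomial, h] using hv

theorem card_support_tail_lt {f : MvPolynomial σ K} (hf : f ≠ 0) :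
    (m.tail f).support.card < f.support.card :=
  Finset.card_lt_card <| (Finset.ssubset_iff_of_subset (m.support_tail_subset f)).2
    ⟨m.lm f, m.lm_mem_support hf, by simp [coeff_lm_tail]⟩

theorem not_le_of_mem_support_tail {f : MvPolynomial σ K} {v : σ →₀ ℕ}
    (hv : v ∈ (m.tail f).support) : ¬ m.le (m.lm f) v := by
  intro h
  have h' := m.antisymm _ _ h (m.le_lm (m.support_tail_subset f hv))
  rw [← h', mem_support_iff] at hv
  exact hv (m.coeff_lm_tail f)

theorem red_tail_mul_add {F : Set (MvPolynomial σ K)} {f q h : MvPolynomial σ K} (hF : q ∈ F)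
    (hf : f ≠ 0) (hq : q ≠ 0) (hh : coeff (m.lm f + m.lm q) h = 0) :
    m.Red F (f * q + h) (m.tail f * q + h) := by
  have hc : coeff (m.lm f + m.lm q) (f * q + h) = m.lc f * m.lc q := by
    rw [coeff_add, hh, add_zero, coeff_lm_add_lm_mul]
  refine ⟨q, hF, hq, m.lm f, ?_, ?_⟩
  · rw [hc]
    exact mul_ne_zero (m.lc_ne_zero hf) (m.lc_ne_zero hq)
  · rw [hc, mul_div_cancel_right₀ _ (m.lc_ne_zero hq), smul_monomial, smul_eq_mul, mul_one, tail]
    ring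

theorem lm_add_lm_ne {f g p q : MvPolynomial σ K} (hcop : ∀ x, min (m.lm p x) (m.lm q x) = 0)
    (hf : ¬ m.le (m.lm p) (m.lm f)) : m.lm f + m.lm q ≠ m.lm g + m.lm p := by
  intro h
  refine hf (m.le_of_pointwise_le fun x => ?_)
  have h₁ := DFunLike.congr_fun h x
  have h₂ := hcop x
  simp only [Finsupp.add_apply] at h₁
  omega

/-- If `p` and `q` have coprime leading monomials, then `f * q + g * p` reduces to `0` as soon as
the monomials of `f` and `g` are smaller than the leading monomials of `p` and `q` respectively. -/
theorem reflTransGen_red_mul_add_mul_zero {p q : MvPolynomial σ K} (hp : p ≠ 0) (hq : q ≠ 0)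
    (hcop : ∀ x, min (m.lm p x) (m.lm q x) = 0) (f g : MvPolynomial σ K)
    (hf : ∀ v ∈ f.support, ¬ m.le (m.lm p) v) (hg : ∀ v ∈ g.support, ¬ m.le (m.lm q) v) :
    ReflTransGen (m.Red {p, q}) (f * q + g * p) 0 := by
  have step_left : f ≠ 0 → coeff (m.lm f + m.lm q) (g * p) = 0 →
      ReflTransGen (m.Red {p, q}) (f * q + g * p) 0 := fun hf0 h => by
    have := m.card_support_tail_lt hf0
    exact .head (m.red_tail_mul_add (by simp) hf0 hq h)
      (reflTransGen_red_mul_add_mul_zero hp hq hcop (m.tail f) g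
        (fun v hv => hf v (m.support_tail_subset f hv)) hg)
  have step_right : g ≠ 0 → coeff (m.lm g + m.lm p) (f * q) = 0 →
      ReflTransGen (m.Red {p, q}) (f * q + g * p) 0 := fun hg0 h => by
    have := m.card_support_tail_lt hg0
    have hred := m.red_tail_mul_add (F := {p, q}) (by simp) hg0 hp h
    rw [add_comm (g * p), add_comm (m.tail g * p)] at hred
    exact .head hred
      (reflTransGen_red_mul_add_mul_zero hp hq hcop f (m.tail g) hf
        (fun v hv => hg v (m.support_tail_subset g hv)))
  by_cases hf0 : f = 0
  · by_cases hg0 : g = 0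
    · simpa [hf0, hg0] using ReflTransGen.refl
    · exact step_right hg0 (by simp [hf0])
  by_cases hg0 : g = 0
  · exact step_left hf0 (by simp [hg0])
  have hne := m.lm_add_lm_ne (g := g) hcop (hf _ (m.lm_mem_support hf0))
  rcases m.total (m.lm f + m.lm q) (m.lm g + m.lm p) with h | h
  · refine step_right hg0 (by_contra fun hc => hne ?_)
    exact m.antisymm _ _ h (m.le_lm_add_lm_of_mem_support_mul (mem_support_iff.2 hc))
  · refine step_left hf0 (by_contra fun hc => hne ?_)
    exact m.antisymm _ _ (m.le_lm_add_lm_of_mem_support_mul (mem_support_iff.2 hc)) h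
termination_by f.support.card + g.support.card

theorem spoly_eq_of_coprime {p q : MvPolynomial σ K} (hp : p ≠ 0) (hq : q ≠ 0)
    (hcop : ∀ x, min (m.lm p x) (m.lm q x) = 0) :
    m.spoly p q = ((m.lc p * m.lc q)⁻¹ • m.tail p) * q +
      (-(m.lc p * m.lc q)⁻¹ • m.tail q) * p := by
  have hlp := m.lc_ne_zero hp
  have hlq := m.lc_ne_zero hq
  have h₁ : m.lm p ⊔ m.lm q - m.lm p = m.lm q := by
    ext x
    have := hcop x
    simp only [Finsupp.tsub_apply, Finsupp.sup_apply]
    omega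
  have h₂ : m.lm p ⊔ m.lm q - m.lm q = m.lm p := by
    ext x
    have := hcop x
    simp only [Finsupp.tsub_apply, Finsupp.sup_apply]
    omega
  have h₃ : monomial (m.lm q) (1 / m.lc p) =
      C (m.lc p * m.lc q)⁻¹ * monomial (m.lm q) (m.lc q) := by
    rw [C_mul_monomial]
    congr 1
    field_simp
  have h₄ : monomial (m.lm p) (1 / m.lc q) =
      C (m.lc p * m.lc q)⁻¹ * monomial (m.lm p) (m.lc p) := by
    rw [C_mul_monomial]
    congr 1
    field_simp
  rw [spoly, if_neg (by simp [hp, hq]), h₁, h₂, h₃, h₄, smul_eq_C_mul, smul_eq_C_mul, C_neg,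
    tail, tail]
  ring

end AdmissibleOrder

/-- Buchberger's product criterion: if the leading monomials of `p` and `q` are coprime,
then their S-polynomial reduces to `0` modulo `{p, q}`. -/
theorem product_criterion {σ K : Type*} [Fintype σ] [Field K] (m : AdmissibleOrder σ)
    (p q : MvPolynomial σ K) (hp : p ≠ 0) (hq : q ≠ 0)
    (hcop : ∀ x, min (m.lm p x) (m.lm q x) = 0) :
    Relation.ReflTransGen (m.Red {p, q}) (m.spoly p q) 0 := by
  rw [m.spoly_eq_of_coprime hp hq hcop]
  exact m.reflTransGen_red_mul_add_mul_zero hp hq hcop _ _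
    (fun v hv => m.not_le_of_mem_support_tail (support_smul hv))
    (fun v hv => m.not_le_of_mem_support_tail (support_smul hv))
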